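/- arXiv:1702.05646 — 11 statements merged into one kernel-verified Lean document; each statement's English description precedes it below -/
import Mathlib

section
/- Let n ≥ 1 and let e₁ denote the first standard basis vector of ℝⁿ. Suppose r : ℝ → ℝⁿ satisfies ‖r(t)‖ = 1 for all t ≥ 0, is differentiable on [0,∞) with r′(t) = e₁ − ⟨e₁, r(t)⟩·r(t) for all t ≥ 0, and that ⟨e₁, r(0)⟩ ≥ 0. Then for all t ≥ 0 one has 1 − ⟨e₁, r(t)⟩ ≤ (1 − ⟨e₁, r(0)⟩)·exp(−t). In particular, on the closed hemisphere {x ∈ ℝⁿ : ‖x‖ = 1, ⟨e₁,x⟩ ≥ 0} the equilibrium e₁ is exponentially stable. -/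
open scoped RealInnerProductSpace

/-- A solution on `[0, ∞)` of `x' = 1 - x²` with values in `[-1, 1]` and `0 ≤ x 0` converges
exponentially to `1`. -/
theorem one_sub_le_mul_exp_neg_of_hasDerivWithinAt {x : ℝ → ℝ}
    (hx : ∀ t ≥ (0 : ℝ), HasDerivWithinAt x (1 - x t ^ 2) (Set.Ici 0) t)
    (hbound : ∀ t ≥ (0 : ℝ), |x t| ≤ 1) (h0 : 0 ≤ x 0) {t : ℝ} (ht : 0 ≤ t) :
    1 - x t ≤ (1 - x 0) * Real.exp (-t) := by
  have hmono : MonotoneOn x (Set.Ici 0) := by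
    refine monotoneOn_of_hasDerivWithinAt_nonneg (convex_Ici 0)
      (fun s hs => (hx s hs).continuousWithinAt)
      (fun s hs => (hx s (interior_subset hs)).mono interior_subset) fun s hs => ?_
    have := (sq_le_one_iff_abs_le_one (x s)).2 (hbound s (interior_subset hs))
    linarith
  have hderiv : ∀ s ≥ (0 : ℝ), HasDerivWithinAt (fun s => (1 - x s) * Real.exp s)
      (-(1 - x s ^ 2) * Real.exp s + (1 - x s) * Real.exp s) (Set.Ici 0) s := fun s hs =>
    ((hx s hs).const_sub 1).mul (Real.hasDerivAt_exp s).hasDerivWithinAt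
  have hanti : AntitoneOn (fun s => (1 - x s) * Real.exp s) (Set.Ici 0) := by
    refine antitoneOn_of_hasDerivWithinAt_nonpos (convex_Ici 0)
      (fun s hs => (hderiv s hs).continuousWithinAt)
      (fun s hs => (hderiv s (interior_subset hs)).mono interior_subset) fun s hs => ?_
    have hs0 : (0 : ℝ) ≤ s := interior_subset (s := Set.Ici (0 : ℝ)) hs
    have hnonneg : 0 ≤ x s := h0.trans (hmono Set.self_mem_Ici hs0 hs0)
    have hle : 0 ≤ 1 - x s := sub_nonneg.2 (abs_le.1 (hbound s hs0)).2
    have := mul_nonneg (mul_nonneg hnonneg hle) (Real.exp_pos s).le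
    linarith
  have hle : (1 - x t) * Real.exp t ≤ 1 - x 0 := by
    simpa using hanti Set.self_mem_Ici ht ht
  rwa [Real.exp_neg, ← div_eq_mul_inv, le_div_iff₀ (Real.exp_pos t)]

theorem reduced_attitude_exponential_stability_on_hemisphere
    (n : ℕ) (hn : 1 ≤ n)
    (e₁ : EuclideanSpace ℝ (Fin n)) (he₁ : e₁ = EuclideanSpace.single ⟨0, hn⟩ 1)
    (r : ℝ → EuclideanSpace ℝ (Fin n))
    (hnorm : ∀ t ≥ (0 : ℝ), ‖r t‖ = 1)
    (hr : ∀ t ≥ (0 : ℝ), HasDerivWithinAt r (e₁ - ⟪e₁, r t⟫ • r t) (Set.Ici 0) t)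
    (h0 : 0 ≤ ⟪e₁, r 0⟫) :
    ∀ t ≥ (0 : ℝ), 1 - ⟪e₁, r t⟫ ≤ (1 - ⟪e₁, r 0⟫) * Real.exp (-t) := by
  have he : ‖e₁‖ = 1 := by simp [he₁]
  intro t ht
  refine one_sub_le_mul_exp_neg_of_hasDerivWithinAt (x := fun t => ⟪e₁, r t⟫)
    (fun s hs => ?_) (fun s hs => ?_) h0 ht
  · refine ((hasDerivWithinAt_const s (Set.Ici 0) e₁).inner ℝ (hr s hs)).congr_deriv ?_
    rw [inner_sub_right, real_inner_smul_right, real_inner_self_eq_norm_sq, he, inner_zero_left]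
    ring
  · simpa [he, hnorm s hs] using abs_real_inner_le_norm e₁ (r s)
end

section
/- Let P ∈ ℝ^{n×n} be an orthogonal projection (Pᵀ = P, P² = P), Q = I − P, let R₀ ∈ SO(n), and set H₀ = R₀P. Define X(t) = sinh(t)·P + (Q + cosh(t)·P)·H₀ and Y(t) = Q + cosh(t)·P + sinh(t)·P·H₀. Then for every t ∈ ℝ the matrix Y(t) is invertible, the function H(t) = X(t)·Y(t)⁻¹ satisfies H(0) = H₀, and H is differentiable at every t with derivative H′(t) = P − H(t)². -/
open Matrix

attribute [local instance] Matrix.normedAddCommGroup Matrix.normedSpace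

/-- The quotient rule in a finite-dimensional, possibly noncommutative, normed algebra. -/
theorem HasDerivAt.mul_ringInverse {A : Type*} [NormedRing A] [NormedAlgebra ℝ A]
    [FiniteDimensional ℝ A] {X Y : ℝ → A} {X' Y' : A} {t : ℝ}
    (hX : HasDerivAt X X' t) (hY : HasDerivAt Y Y' t) (hu : IsUnit (Y t)) :
    HasDerivAt (fun s => X s * Ring.inverse (Y s))
      (X' * Ring.inverse (Y t) - X t * Ring.inverse (Y t) * (Y' * Ring.inverse (Y t))) t := by
  have := FiniteDimensional.complete ℝ A
  obtain ⟨u, hu⟩ := hu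
  have hinv := hasFDerivAt_ringInverse (𝕜 := ℝ) u
  have huinv : Ring.inverse (Y t) = (u⁻¹ : Aˣ) := by
    rw [← hu, Ring.inverse_unit]
  rw [hu] at hinv
  refine (hX.mul (hinv.comp_hasDerivAt t hY)).congr_deriv ?_
  simp [huinv, mul_assoc, sub_eq_add_neg]

/-- The quotient rule for matrix-valued functions. -/
theorem Matrix.hasDerivAt_mul_inv {n : ℕ} {X Y : ℝ → Matrix (Fin n) (Fin n) ℝ}
    {X' Y' : Matrix (Fin n) (Fin n) ℝ} {t : ℝ}
    (hX : HasDerivAt X X' t) (hY : HasDerivAt Y Y' t) (hu : IsUnit (Y t)) :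
    HasDerivAt (fun s => X s * (Y s)⁻¹)
      (X' * (Y t)⁻¹ - X t * (Y t)⁻¹ * (Y' * (Y t)⁻¹)) t := by
  let := Matrix.linftyOpNormedRing (n := Fin n) (α := ℝ)
  let := Matrix.linftyOpNormedAlgebra (n := Fin n) (R := ℝ) (α := ℝ)
  simp only [Matrix.nonsing_inv_eq_ringInverse]
  exact HasDerivAt.mul_ringInverse hX hY hu

/-- A symmetric idempotent matrix does not increase the Euclidean length of a vector. -/
theorem Matrix.dotProduct_mulVec_self_le_of_proj {n : ℕ} {P : Matrix (Fin n) (Fin n) ℝ}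
    (hPsym : Pᵀ = P) (hPproj : P * P = P) (w : Fin n → ℝ) :
    (P *ᵥ w) ⬝ᵥ (P *ᵥ w) ≤ w ⬝ᵥ w := by
  have hPw : (P *ᵥ w) ⬝ᵥ (P *ᵥ w) = w ⬝ᵥ (P *ᵥ w) := by
    nth_rewrite 1 [← hPsym]
    rw [Matrix.mulVec_transpose, ← Matrix.dotProduct_mulVec, Matrix.mulVec_mulVec, hPproj]
  have hnonneg : 0 ≤ (w - P *ᵥ w) ⬝ᵥ (w - P *ᵥ w) :=
    Finset.sum_nonneg fun i _ => mul_self_nonneg _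
  rw [sub_dotProduct, dotProduct_sub, dotProduct_sub, dotProduct_comm (P *ᵥ w) w] at hnonneg
  linarith

/-- The matrix `cosh (P t) + sinh (P t) R P` is invertible for `P` an orthogonal projection and
`R` orthogonal. -/
theorem Matrix.isUnit_cosh_add_sinh_proj {n : ℕ} {P R : Matrix (Fin n) (Fin n) ℝ}
    (hPsym : Pᵀ = P) (hPproj : P * P = P) (hR : Rᵀ * R = 1) (t : ℝ) :
    IsUnit (1 - P + Real.cosh t • P + Real.sinh t • (P * (R * P))) := by
  rw [← Matrix.mulVec_injective_iff_isUnit, ← Matrix.coe_mulVecLin, injective_iff_map_eq_zero]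
  intro v hv
  rw [Matrix.mulVecLin_apply] at hv
  have hQY : (1 - P) * (1 - P + Real.cosh t • P + Real.sinh t • (P * (R * P))) = 1 - P := by
    have h0 : (1 - P) * P = 0 := by rw [sub_mul, one_mul, hPproj, sub_self]
    rw [mul_add, mul_add, mul_smul_comm, mul_smul_comm, ← mul_assoc (1 - P) P, h0,
      mul_sub, h0]
    simp
  have hPv : P *ᵥ v = v := by
    have h := congrArg ((1 - P) *ᵥ ·) hv
    simp only [Matrix.mulVec_mulVec, hQY, Matrix.mulVec_zero, Matrix.sub_mulVec,
      Matrix.one_mulVec] at h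
    exact (sub_eq_zero.mp h).symm
  have hv' : Real.cosh t • v = -(Real.sinh t • (P *ᵥ (R *ᵥ v))) := by
    simp only [Matrix.add_mulVec, Matrix.sub_mulVec, Matrix.smul_mulVec, Matrix.one_mulVec,
      ← Matrix.mulVec_mulVec, hPv, sub_self, zero_add] at hv
    exact eq_neg_of_add_eq_zero_left hv
  have hRv : (R *ᵥ v) ⬝ᵥ (R *ᵥ v) = v ⬝ᵥ v := by
    rw [Matrix.dotProduct_mulVec, ← Matrix.mulVec_transpose, Matrix.mulVec_mulVec, hR,
      Matrix.one_mulVec]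
  have hle := Matrix.dotProduct_mulVec_self_le_of_proj hPsym hPproj (R *ᵥ v)
  rw [hRv] at hle
  have hsq := congrArg (fun x => x ⬝ᵥ x) hv'
  simp only [smul_dotProduct, dotProduct_smul, neg_dotProduct, dotProduct_neg,
    smul_eq_mul] at hsq
  have hnonneg : 0 ≤ v ⬝ᵥ v := Finset.sum_nonneg fun i _ => mul_self_nonneg _
  refine dotProduct_self_eq_zero.mp (le_antisymm ?_ hnonneg)
  nlinarith [Real.cosh_sq t, mul_le_mul_of_nonneg_left hle (sq_nonneg (Real.sinh t))]

theorem exact_solution_RP_flow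
    (n : ℕ) (P R₀ : Matrix (Fin n) (Fin n) ℝ)
    (hPsym : Pᵀ = P) (hPproj : P * P = P)
    (Q : Matrix (Fin n) (Fin n) ℝ) (hQ : Q = 1 - P)
    (hR₀ : R₀ᵀ * R₀ = 1) (hdet : R₀.det = 1)
    (H₀ : Matrix (Fin n) (Fin n) ℝ) (hH₀ : H₀ = R₀ * P)
    (X Y : ℝ → Matrix (Fin n) (Fin n) ℝ)
    (hX : ∀ t, X t = Real.sinh t • P + (Q + Real.cosh t • P) * H₀)
    (hY : ∀ t, Y t = Q + Real.cosh t • P + Real.sinh t • (P * H₀)) :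
    (∀ t : ℝ, IsUnit (Y t)) ∧
      X 0 * (Y 0)⁻¹ = H₀ ∧
      (∀ t : ℝ, HasDerivAt (fun s => X s * (Y s)⁻¹)
        (P - (X t * (Y t)⁻¹) * (X t * (Y t)⁻¹)) t) := by
  have hunit : ∀ t, IsUnit (Y t) := fun t => by
    rw [hY, hQ, hH₀]
    exact Matrix.isUnit_cosh_add_sinh_proj hPsym hPproj hR₀ t
  refine ⟨hunit, by simp [hX, hY, hQ], fun t => ?_⟩
  have hPQ : P * Q = 0 := by rw [hQ, mul_sub, mul_one, hPproj, sub_self]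
  have hH₀Q : H₀ * Q = 0 := by rw [hH₀, mul_assoc, hPQ, mul_zero]
  have hQQ : Q * Q = Q := by
    nth_rewrite 1 [hQ]
    rw [sub_mul, one_mul, hPQ, sub_zero]
  have hXQ : X t * Q = 0 := by simp [hX, add_mul, mul_assoc, hPQ, hH₀Q]
  have hYQ : Y t * Q = Q := by simp [hY, add_mul, mul_assoc, hPQ, hH₀Q, hQQ]
  have hX' : HasDerivAt X (P * Y t) t := by
    have hval : P * Y t = Real.cosh t • P + Real.sinh t • (P * H₀) := by
      simp [hY, mul_add, hPQ, hPproj, ← mul_assoc]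
    have hfun : X = fun s => Real.sinh s • P + (Q * H₀ + Real.cosh s • (P * H₀)) := by
      funext s
      rw [hX, add_mul, smul_mul_assoc]
    rw [hval, hfun]
    exact ((Real.hasDerivAt_sinh t).smul_const P).add
      (((Real.hasDerivAt_cosh t).smul_const (P * H₀)).const_add (Q * H₀))
  have hY' : HasDerivAt Y (P * X t) t := by
    have hval : P * X t = Real.sinh t • P + Real.cosh t • (P * H₀) := by
      simp [hX, mul_add, add_mul, hPQ, hPproj, ← mul_assoc]
    rw [hval, funext hY]
    exact (((Real.hasDerivAt_cosh t).smul_const P).const_add Q).add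
      ((Real.hasDerivAt_sinh t).smul_const (P * H₀))
  have hdetY : IsUnit (Y t).det := (Matrix.isUnit_iff_isUnit_det _).mp (hunit t)
  have hHQ : X t * (Y t)⁻¹ * Q = 0 := by
    rw [← hYQ, mul_assoc, Matrix.nonsing_inv_mul_cancel_left _ _ hdetY, hXQ]
  have hHP : X t * (Y t)⁻¹ * P = X t * (Y t)⁻¹ := by
    rw [hQ, mul_sub, mul_one, sub_eq_zero] at hHQ
    exact hHQ.symm
  convert Matrix.hasDerivAt_mul_inv hX' hY' (hunit t) using 1
  rw [Matrix.mul_nonsing_inv_cancel_right _ _ hdetY, mul_assoc P (X t), ← mul_assoc _ P, hHP]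
end

section
/- Let P ∈ ℝ^{n×n} be an orthogonal projection (Pᵀ = P, P² = P), Q = I − P, and let R₀ ∈ SO(n). Then for every t ∈ ℝ the matrix Q + cosh(t)·P + sinh(t)·(P·R₀·P) is invertible. -/
open Matrix

/-- An orthogonal projection does not increase the Euclidean length of a vector. -/
theorem dotProduct_mulVec_self_le_of_projection {ι : Type*} [Fintype ι] {P : Matrix ι ι ℝ}
    (hPsym : Pᵀ = P) (hPproj : P * P = P) (w : ι → ℝ) :
    (P *ᵥ w) ⬝ᵥ (P *ᵥ w) ≤ w ⬝ᵥ w := by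
  have h : (P *ᵥ w) ⬝ᵥ (P *ᵥ w) = w ⬝ᵥ (P *ᵥ w) := by
    rw [dotProduct_mulVec, ← mulVec_transpose, hPsym, mulVec_mulVec, hPproj, dotProduct_comm]
  have hnonneg : 0 ≤ (w - P *ᵥ w) ⬝ᵥ (w - P *ᵥ w) :=
    Finset.sum_nonneg fun i _ => mul_self_nonneg _
  rw [sub_dotProduct, dotProduct_sub, dotProduct_sub, dotProduct_comm (P *ᵥ w) w] at hnonneg
  linarith

/-- A matrix with orthonormal columns preserves the Euclidean length of vectors. -/
theorem dotProduct_mulVec_self_of_transpose_mul_self {m ι : Type*} [Fintype m] [Fintype ι]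
    [DecidableEq ι] {R : Matrix m ι ℝ} (hR : Rᵀ * R = 1) (v : ι → ℝ) :
    (R *ᵥ v) ⬝ᵥ (R *ᵥ v) = v ⬝ᵥ v := by
  rw [dotProduct_mulVec, ← mulVec_transpose, mulVec_mulVec, hR, one_mulVec]

theorem Y_invertible
    (n : ℕ) (P R₀ : Matrix (Fin n) (Fin n) ℝ)
    (hPsym : Pᵀ = P) (hPproj : P * P = P)
    (Q : Matrix (Fin n) (Fin n) ℝ) (hQ : Q = 1 - P)
    (hR₀ : R₀ᵀ * R₀ = 1) (hdet : R₀.det = 1) :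
    ∀ t : ℝ, IsUnit (Q + Real.cosh t • P + Real.sinh t • (P * R₀ * P)) := by
  intro t
  rw [← mulVec_injective_iff_isUnit]
  refine (injective_iff_map_eq_zero
    (mulVecLin (Q + Real.cosh t • P + Real.sinh t • (P * R₀ * P)))).2 fun v hv => ?_
  rw [mulVecLin_apply] at hv
  have hQP : Q * P = 0 := by rw [hQ, sub_mul, one_mul, hPproj, sub_self]
  have hQQ : Q * Q = Q := by
    nth_rewrite 2 [hQ]
    rw [mul_sub, mul_one, hQP, sub_zero]
  have hQv : Q *ᵥ v = 0 := by
    have h := congrArg (Q *ᵥ ·) hv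
    simpa [mulVec_mulVec, mul_add, ← mul_assoc, hQP, hQQ] using h
  have hPv : P *ᵥ v = v := by
    rw [hQ, sub_mulVec, one_mulVec, sub_eq_zero] at hQv
    exact hQv.symm
  rw [add_mulVec, add_mulVec, hQv, zero_add, smul_mulVec, smul_mulVec, ← mulVec_mulVec,
    ← mulVec_mulVec, hPv] at hv
  have hnorm := congrArg (fun x => x ⬝ᵥ x) (eq_neg_of_add_eq_zero_left hv)
  simp only [neg_dotProduct, dotProduct_neg, smul_dotProduct, dotProduct_smul,
    smul_eq_mul] at hnorm
  have hle := dotProduct_mulVec_self_le_of_projection hPsym hPproj (R₀ *ᵥ v)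
  rw [dotProduct_mulVec_self_of_transpose_mul_self hR₀] at hle
  have hzero : v ⬝ᵥ v ≤ 0 := by
    nlinarith [Real.cosh_sq t, mul_le_mul_of_nonneg_left hle (sq_nonneg (Real.sinh t))]
  exact dotProduct_self_eq_zero.1
    (le_antisymm hzero (Finset.sum_nonneg fun i _ => mul_self_nonneg _))
end

section
/- Let P ∈ ℝ^{n×n} be an orthogonal projection (Pᵀ = P, P² = P) and let R ∈ ℝ^{n×n} be orthogonal (RᵀR = I). If v ∈ ℝⁿ satisfies (P·R·P)·v = −v, then R·v = −v. In particular, if −1 is not an eigenvalue of R, then −1 is not an eigenvalue of P·R·P. -/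
open Matrix

theorem eigenvalue_neg_one_PRP
    (n : ℕ) (P R : Matrix (Fin n) (Fin n) ℝ)
    (hPsym : Pᵀ = P) (hPproj : P * P = P)
    (hR : Rᵀ * R = 1)
    (v : Fin n → ℝ) (hv : (P * R * P).mulVec v = -v) :
    R.mulVec v = -v := by
  have hPv : P *ᵥ v = v := by
    have h : P *ᵥ ((P * R * P) *ᵥ v) = (P * R * P) *ᵥ v := by
      rw [mulVec_mulVec, ← mul_assoc, ← mul_assoc, hPproj]
    rw [hv, mulVec_neg] at h
    exact neg_injective h
  have hPRv : P *ᵥ (R *ᵥ v) = -v := by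
    rw [← hv, ← mulVec_mulVec, hPv, mulVec_mulVec]
  have hnorm : (R *ᵥ v) ⬝ᵥ (R *ᵥ v) = v ⬝ᵥ v := by
    rw [dotProduct_mulVec, ← mulVec_transpose, mulVec_mulVec, hR, one_mulVec]
  have hinner : v ⬝ᵥ (R *ᵥ v) = -(v ⬝ᵥ v) := by
    calc v ⬝ᵥ (R *ᵥ v) = (Pᵀ *ᵥ v) ⬝ᵥ (R *ᵥ v) := by rw [hPsym, hPv]
      _ = v ⬝ᵥ (P *ᵥ (R *ᵥ v)) := by rw [mulVec_transpose, ← dotProduct_mulVec]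
      _ = -(v ⬝ᵥ v) := by rw [hPRv, dotProduct_neg]
  rw [← add_eq_zero_iff_eq_neg, ← dotProduct_self_eq_zero, add_dotProduct, dotProduct_add,
    dotProduct_add, dotProduct_comm (R *ᵥ v) v, hnorm, hinner]
  ring
end

section
/- Let P ∈ ℝ^{n×n} be an orthogonal projection (Pᵀ = P, P² = P), Q = I − P, and let R₀ ∈ SO(n) be such that −1 is not an eigenvalue of R₀ (i.e. R₀v = −v implies v = 0 for v ∈ ℝⁿ). Define H(t) = [sinh(t)·P + (Q + cosh(t)·P)·R₀P]·[Q + cosh(t)·P + sinh(t)·P·R₀·P]⁻¹. Then H(t) tends to P as t → ∞. -/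
open Matrix Filter

attribute [local instance] Matrix.normedAddCommGroup Matrix.normedSpace

theorem Real.tendsto_inv_cosh_atTop : Tendsto (fun t => (Real.cosh t)⁻¹) atTop (nhds 0) := by
  refine (tendsto_atTop_mono (fun t => ?_) tendsto_id).inv_tendsto_atTop
  rcases le_total 0 t with ht | ht
  · exact (Real.self_le_sinh_iff.2 ht).trans (Real.sinh_lt_cosh t).le
  · exact ht.trans (Real.cosh_pos t).le

theorem Real.tendsto_sinh_div_cosh_atTop :
    Tendsto (fun t => Real.sinh t / Real.cosh t) atTop (nhds 1) := by
  have h : Tendsto (fun t => 1 - Real.exp (-t) * (Real.cosh t)⁻¹) atTop (nhds (1 - 0 * 0)) :=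
    ((Real.tendsto_exp_neg_atTop_nhds_zero).mul Real.tendsto_inv_cosh_atTop).const_sub 1
  simp only [mul_zero, sub_zero] at h
  refine h.congr fun t => ?_
  have := (Real.cosh_pos t).ne'
  rw [← Real.cosh_sub_sinh]
  field_simp
  ring

/-- If `R` is orthogonal without eigenvalue `-1`, its compression to the range of an orthogonal
projection does not have eigenvalue `-1` either. -/
theorem Matrix.det_one_add_compression_ne_zero {m : Type*} [Fintype m] [DecidableEq m]
    {P R : Matrix m m ℝ} (hPsym : Pᵀ = P) (hPproj : P * P = P) (hR : Rᵀ * R = 1)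
    (hspec : ∀ v : m → ℝ, R *ᵥ v = -v → v = 0) : (1 + P * R * P).det ≠ 0 := by
  intro hdet
  obtain ⟨v, hv, h⟩ := Matrix.exists_mulVec_eq_zero_iff.2 hdet
  rw [Matrix.add_mulVec, Matrix.one_mulVec] at h
  have hcomp : (P * R * P) *ᵥ v = -v := (neg_eq_of_add_eq_zero_right h).symm
  have hPv : P *ᵥ v = v := by
    have := congrArg (P *ᵥ ·) hcomp
    simp only [Matrix.mulVec_mulVec, Matrix.mulVec_neg, ← Matrix.mul_assoc, hPproj] at this
    rw [hcomp] at this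
    exact (neg_injective this).symm
  have hPRv : P *ᵥ (R *ᵥ v) = -v := by
    rwa [← Matrix.mulVec_mulVec, hPv, ← Matrix.mulVec_mulVec] at hcomp
  have hinner : v ⬝ᵥ R *ᵥ v = -(v ⬝ᵥ v) := by
    calc v ⬝ᵥ R *ᵥ v = (P *ᵥ v) ⬝ᵥ R *ᵥ v := by rw [hPv]
      _ = v ⬝ᵥ P *ᵥ (R *ᵥ v) := by
        rw [Matrix.dotProduct_mulVec v P, ← Matrix.mulVec_transpose, hPsym]
      _ = -(v ⬝ᵥ v) := by rw [hPRv, dotProduct_neg]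
  have hnorm : (R *ᵥ v) ⬝ᵥ (R *ᵥ v) = v ⬝ᵥ v := by
    rw [Matrix.dotProduct_mulVec, ← Matrix.mulVec_transpose, Matrix.mulVec_mulVec, hR,
      Matrix.one_mulVec]
  have hzero : (R *ᵥ v + v) ⬝ᵥ (R *ᵥ v + v) = 0 := by
    rw [add_dotProduct, dotProduct_add, dotProduct_add, hnorm, dotProduct_comm (R *ᵥ v) v, hinner]
    ring
  exact hv (hspec v (eq_neg_of_add_eq_zero_left (dotProduct_self_eq_zero.1 hzero)))

theorem Matrix.tendsto_inv_of_det_ne_zero {m α : Type*} [Fintype m] [DecidableEq m]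
    {l : Filter α} {f : α → Matrix m m ℝ} {A : Matrix m m ℝ} (hf : Tendsto f l (nhds A))
    (hA : A.det ≠ 0) : Tendsto (fun x => (f x)⁻¹) l (nhds A⁻¹) := by
  refine (continuousAt_matrix_inv A ?_).tendsto.comp hf
  rw [Ring.inverse_eq_inv']
  exact continuousAt_inv₀ hA

theorem H_tendsto_P
    (n : ℕ) (P R₀ : Matrix (Fin n) (Fin n) ℝ)
    (hPsym : Pᵀ = P) (hPproj : P * P = P)
    (Q : Matrix (Fin n) (Fin n) ℝ) (hQ : Q = 1 - P)
    (hR₀ : R₀ᵀ * R₀ = 1) (hdet : R₀.det = 1)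
    (hspec : ∀ v : Fin n → ℝ, R₀.mulVec v = -v → v = 0)
    (H : ℝ → Matrix (Fin n) (Fin n) ℝ)
    (hH : ∀ t, H t = (Real.sinh t • P + (Q + Real.cosh t • P) * (R₀ * P)) *
        (Q + Real.cosh t • P + Real.sinh t • (P * R₀ * P))⁻¹) :
    Tendsto H atTop (nhds P) := by
  have hunit := Matrix.det_one_add_compression_ne_zero hPsym hPproj hR₀ hspec
  have hPQ : P * Q = 0 := by rw [hQ, mul_sub, mul_one, hPproj, sub_self]
  have hQP : Q * P = 0 := by rw [hQ, sub_mul, one_mul, hPproj, sub_self]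
  have hQQ : Q * Q = Q := by
    nth_rewrite 1 [hQ]
    rw [sub_mul, one_mul, hPQ, sub_zero]
  have hsum : Q + P = 1 := by rw [hQ, sub_add_cancel]
  have hform : ∀ t, H t = ((Real.sinh t / Real.cosh t) • P + (Real.cosh t)⁻¹ • (Q * R₀ * P)
      + P * R₀ * P) * (1 + (Real.sinh t / Real.cosh t) • (P * R₀ * P))⁻¹ := by
    intro t
    have hc : Real.cosh t ≠ 0 := (Real.cosh_pos t).ne'
    have hfactor : Q + Real.cosh t • P + Real.sinh t • (P * R₀ * P) =
        (1 + (Real.sinh t / Real.cosh t) • (P * R₀ * P)) * (Q + Real.cosh t • P) := by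
      simp only [add_mul, mul_add, one_mul, smul_mul_assoc, mul_smul_comm, Matrix.mul_assoc, hPQ,
        hPproj, mul_zero, smul_zero, add_zero, smul_add, smul_smul]
      rw [mul_div_cancel₀ _ hc, add_assoc]
    have hinv : (Q + Real.cosh t • P)⁻¹ = Q + (Real.cosh t)⁻¹ • P := by
      refine Matrix.inv_eq_right_inv ?_
      simp only [add_mul, mul_add, smul_mul_assoc, mul_smul_comm, hPQ, hQP, hQQ, hPproj,
        smul_zero, add_zero, zero_add, smul_smul]
      rw [inv_mul_cancel₀ hc, one_smul, hsum]
    rw [hH, hfactor, Matrix.mul_inv_rev, hinv, ← Matrix.mul_assoc]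
    congr 1
    simp only [add_mul, mul_add, smul_mul_assoc, mul_smul_comm, Matrix.mul_assoc, hPQ, hPproj,
      mul_zero, smul_zero, zero_add, smul_smul, smul_add]
    rw [inv_mul_cancel₀ hc, one_smul, div_eq_inv_mul, add_assoc]
  have hnum : Tendsto (fun t => (Real.sinh t / Real.cosh t) • P
      + (Real.cosh t)⁻¹ • (Q * R₀ * P) + P * R₀ * P) atTop
      (nhds ((1 : ℝ) • P + (0 : ℝ) • (Q * R₀ * P) + P * R₀ * P)) :=
    ((Real.tendsto_sinh_div_cosh_atTop.smul_const P).add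
      (Real.tendsto_inv_cosh_atTop.smul_const (Q * R₀ * P))).add_const _
  have hden : Tendsto (fun t => 1 + (Real.sinh t / Real.cosh t) • (P * R₀ * P)) atTop
      (nhds (1 + (1 : ℝ) • (P * R₀ * P))) :=
    (Real.tendsto_sinh_div_cosh_atTop.smul_const (P * R₀ * P)).const_add _
  rw [one_smul] at hden
  have hlim := hnum.mul (Matrix.tendsto_inv_of_det_ne_zero hden hunit)
  have hval : ((1 : ℝ) • P + (0 : ℝ) • (Q * R₀ * P) + P * R₀ * P) * (1 + P * R₀ * P)⁻¹ = P := by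
    have hleft : (1 : ℝ) • P + (0 : ℝ) • (Q * R₀ * P) + P * R₀ * P = P * (1 + P * R₀ * P) := by
      rw [one_smul, zero_smul, add_zero, mul_add, mul_one, ← Matrix.mul_assoc P (P * R₀),
        ← Matrix.mul_assoc P P, hPproj]
    rw [hleft, Matrix.mul_nonsing_inv_cancel_right _ _ (isUnit_iff_ne_zero.2 hunit)]
  rw [hval] at hlim
  exact hlim.congr fun t => (hform t).symm
end

section
/- Let P ∈ ℝ^{n×n} be an orthogonal projection (Pᵀ = P, P² = P), Q = I − P, let k ≥ 0, and let R ∈ SO(n). Then trace(P·R·R) + k·trace((Q·R·Q)·(Q·R·Q)) ≤ trace(P) + k·trace((Q·R·Q)ᵀ·(Q·R·Q)). Equivalently, the derivative V̇ = −trace P + ⟨P, R²⟩ − k‖QRQ‖²_F + k⟨QRᵀQ, QRQ⟩ of the Lyapunov function V(R) = trace(I − R) along the closed-loop flow Ṙ = P − RPR + kRQ(Rᵀ − R)Q is nonpositive. -/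
open Matrix

/-- Young's inequality for the Frobenius inner product. -/
theorem two_mul_trace_transpose_mul_le {m n : Type*} [Fintype m] [Fintype n]
    (X Y : Matrix m n ℝ) :
    2 * (Xᵀ * Y).trace ≤ (Xᵀ * X).trace + (Yᵀ * Y).trace := by
  have hnonneg : 0 ≤ ((X - Y)ᵀ * (X - Y)).trace := by
    simp only [trace, diag_apply, mul_apply, transpose_apply]
    exact Finset.sum_nonneg fun i _ => Finset.sum_nonneg fun j _ => mul_self_nonneg _
  have hsymm : (Yᵀ * X).trace = (Xᵀ * Y).trace := by
    rw [← trace_transpose, transpose_mul, transpose_transpose]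
  simp only [transpose_sub, Matrix.sub_mul, Matrix.mul_sub, trace_sub] at hnonneg
  linarith

theorem trace_mul_self_le_trace_transpose_mul_self {n : Type*} [Fintype n]
    (A : Matrix n n ℝ) : (A * A).trace ≤ (Aᵀ * A).trace := by
  have h := two_mul_trace_transpose_mul_le Aᵀ A
  rw [transpose_transpose, trace_mul_comm A Aᵀ] at h
  linarith

theorem trace_projection_mul_orthogonal_sq_le {n : Type*} [Fintype n] [DecidableEq n]
    {P R : Matrix n n ℝ} (hPsym : Pᵀ = P) (hPproj : P * P = P) (hR : Rᵀ * R = 1) :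
    (P * R * R).trace ≤ P.trace := by
  have hR' : R * Rᵀ = 1 := mul_eq_one_comm.mp hR
  have h := two_mul_trace_transpose_mul_le (Rᵀ * P) (R * P)
  have hX : (Rᵀ * P)ᵀ * (Rᵀ * P) = P := by
    rw [transpose_mul, transpose_transpose, hPsym, Matrix.mul_assoc, ← Matrix.mul_assoc R,
      hR', Matrix.one_mul, hPproj]
  have hY : (R * P)ᵀ * (R * P) = P := by
    rw [transpose_mul, hPsym, Matrix.mul_assoc, ← Matrix.mul_assoc Rᵀ,
      hR, Matrix.one_mul, hPproj]
  have hXY : ((Rᵀ * P)ᵀ * (R * P)).trace = (P * R * R).trace := by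
    rw [transpose_mul, transpose_transpose, hPsym, ← Matrix.mul_assoc, trace_mul_comm,
      ← Matrix.mul_assoc, ← Matrix.mul_assoc, hPproj]
  rw [hX, hY, hXY] at h
  linarith

theorem lyapunov_derivative_nonpositive
    (n : ℕ) (P R : Matrix (Fin n) (Fin n) ℝ)
    (hPsym : Pᵀ = P) (hPproj : P * P = P)
    (Q : Matrix (Fin n) (Fin n) ℝ) (hQ : Q = 1 - P)
    (k : ℝ) (hk : 0 ≤ k)
    (hR : Rᵀ * R = 1) (hdet : R.det = 1) :
    (P * R * R).trace + k * ((Q * R * Q) * (Q * R * Q)).trace ≤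
      P.trace + k * ((Q * R * Q)ᵀ * (Q * R * Q)).trace := by
  exact add_le_add (trace_projection_mul_orthogonal_sq_le hPsym hPproj hR)
    (mul_le_mul_of_nonneg_left (trace_mul_self_le_trace_transpose_mul_self _) hk)
end

section
/- Let P ∈ ℝ^{n×n} be an orthogonal projection (Pᵀ = P, P² = P) and let R ∈ SO(n). If trace(P·R·R) = trace(P), then R·R·P = P. -/
open Matrix

theorem trace_PRR_eq_trace_P_implies
    (n : ℕ) (P R : Matrix (Fin n) (Fin n) ℝ)
    (hPsym : Pᵀ = P) (hPproj : P * P = P)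
    (hR : Rᵀ * R = 1) (hdet : R.det = 1)
    (htr : (P * R * R).trace = P.trace) :
    R * R * P = P := by
  obtain ⟨Q, hQ⟩ : ∃ Q, Q = R * R := ⟨_, rfl⟩
  have hQQ : Qᵀ * Q = 1 := by
    rw [hQ, transpose_mul, Matrix.mul_assoc, ← Matrix.mul_assoc Rᵀ R R, hR, Matrix.one_mul, hR]
  rw [Matrix.mul_assoc, ← hQ] at htr
  rw [← hQ, ← sub_eq_zero, ← trace_conjTranspose_mul_self_eq_zero_iff,
    conjTranspose_eq_transpose_of_trivial]
  have hexpand : (Q * P - P)ᵀ * (Q * P - P) = P + P - (P * Qᵀ * P + P * Q * P) := by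
    have hPQQP : P * Qᵀ * (Q * P) = P := by
      rw [Matrix.mul_assoc, ← Matrix.mul_assoc Qᵀ, hQQ, Matrix.one_mul, hPproj]
    rw [transpose_sub, transpose_mul, hPsym, Matrix.sub_mul, Matrix.mul_sub, Matrix.mul_sub,
      hPQQP, hPproj, ← Matrix.mul_assoc]
    abel
  have hcompress : (P * Q * P).trace = P.trace := by
    rw [trace_mul_comm, ← Matrix.mul_assoc, hPproj, htr]
  have hcompress_transpose : (P * Qᵀ * P).trace = P.trace := by
    rw [← hcompress, ← trace_transpose (P * Q * P), transpose_mul, transpose_mul, hPsym,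
      Matrix.mul_assoc]
  rw [hexpand, trace_sub, trace_add, trace_add, hcompress, hcompress_transpose, sub_self]
end

section
/- Let P ∈ ℝ^{n×n} be an orthogonal projection (Pᵀ = P, P² = P), Q = I − P, and let R ∈ SO(n) satisfy R·R·P = P, (R·P)·(R·P) = P, and Q·R·Q = Q·Rᵀ·Q. Then R is symmetric (Rᵀ = R) and R commutes with P (R·P = P·R). In particular the spectrum of R is contained in {−1, 1} and R is an equilibrium of the closed-loop flow Ṙ = P − RPR + kRQ(Rᵀ − R)Q for every k. -/
open Matrix

theorem equilibria_symmetric_and_commute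
    (n : ℕ) (P R : Matrix (Fin n) (Fin n) ℝ)
    (hPsym : Pᵀ = P) (hPproj : P * P = P)
    (Q : Matrix (Fin n) (Fin n) ℝ) (hQ : Q = 1 - P)
    (hR : Rᵀ * R = 1) (hdet : R.det = 1)
    (h1 : R * R * P = P) (h2 : (R * P) * (R * P) = P)
    (h3 : Q * R * Q = Q * Rᵀ * Q) :
    Rᵀ = R ∧ R * P = P * R := by
  have hRtP : Rᵀ * P = R * P := by
    calc Rᵀ * P = Rᵀ * (R * R * P) := by rw [h1]
      _ = (Rᵀ * R) * (R * P) := by simp only [Matrix.mul_assoc]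
      _ = R * P := by rw [hR, Matrix.one_mul]
  have hPRP : P * (R * P) = R * P := by
    calc P * (R * P) = (Rᵀ * R) * (P * (R * P)) := by rw [hR, Matrix.one_mul]
      _ = Rᵀ * ((R * P) * (R * P)) := by simp only [Matrix.mul_assoc]
      _ = R * P := by rw [h2, hRtP]
  have hPRt : P * Rᵀ = P * R := by
    simpa [Matrix.transpose_mul, hPsym] using (congrArg Matrix.transpose hRtP).symm
  have hcomm : R * P = P * R := by
    have h := congrArg Matrix.transpose hPRP
    simp only [Matrix.transpose_mul, hPsym] at h
    rw [← hPRt, ← h, Matrix.mul_assoc, hRtP, hPRP]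
  refine ⟨?_, hcomm⟩
  subst hQ
  simp only [Matrix.sub_mul, Matrix.mul_sub, Matrix.one_mul, Matrix.mul_one, hPRt, hRtP] at h3
  exact (sub_left_injective (sub_left_injective h3)).symm
end

section
/- Let n ≥ 1 and let m be a natural number with 2m ≤ n. Then the set M = {R ∈ ℝ^{n×n} : RᵀR = I, det R = 1, Rᵀ = R, trace R = n − 4m} of symmetric special orthogonal matrices whose eigenvalue −1 has multiplicity 2m is a nonempty path-connected subset of ℝ^{n×n}. -/
open Matrix

namespace SymmetricRotation

variable {ι : Type*} [Fintype ι] [DecidableEq ι]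

/-- The symmetric matrices in `SO(ι)` with trace `c`. -/
def symmetricRotations (ι : Type*) [Fintype ι] [DecidableEq ι] (c : ℝ) : Set (Matrix ι ι ℝ) :=
  {R | Rᵀ * R = 1 ∧ R.det = 1 ∧ Rᵀ = R ∧ R.trace = c}

/-- The matrix of the reflection in the hyperplane orthogonal to `v`, and `1` if `v = 0`. -/
noncomputable def householder (v : ι → ℝ) : Matrix ι ι ℝ :=
  1 - (2 / (v ⬝ᵥ v)) • vecMulVec v v

theorem conj_mem_symmetricRotations {c : ℝ} {R U : Matrix ι ι ℝ}
    (hR : R ∈ symmetricRotations ι c) (hU : Uᵀ * U = 1) :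
    U * R * Uᵀ ∈ symmetricRotations ι c := by
  obtain ⟨h₁, h₂, h₃, h₄⟩ := hR
  refine ⟨?_, ?_, ?_, ?_⟩
  · have hU' : U * Uᵀ = 1 := mul_eq_one_comm.mp hU
    calc (U * R * Uᵀ)ᵀ * (U * R * Uᵀ) = U * (Rᵀ * (Uᵀ * U) * R) * Uᵀ := by
          simp only [transpose_mul, transpose_transpose, Matrix.mul_assoc]
      _ = 1 := by rw [hU, Matrix.mul_one, h₁, Matrix.mul_one, hU']
  · have hdet : Uᵀ.det * U.det = 1 := by rw [← det_mul, hU, det_one]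
    rw [det_mul, det_mul, h₂, mul_one, mul_comm, hdet]
  · simp only [transpose_mul, transpose_transpose, h₃, Matrix.mul_assoc]
  · rw [trace_mul_comm, ← Matrix.mul_assoc, hU, Matrix.one_mul, h₄]

theorem householder_transpose (v : ι → ℝ) : (householder v)ᵀ = householder v := by
  simp [householder, transpose_vecMulVec]

theorem householder_mul_self (v : ι → ℝ) : householder v * householder v = 1 := by
  by_cases hv : v ⬝ᵥ v = 0
  · simp [householder, hv]
  · have hsq : vecMulVec v v * vecMulVec v v = (v ⬝ᵥ v) • vecMulVec v v := by
      rw [vecMulVec_mul_vecMulVec, vecMulVec_smul]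
    simp only [householder, Matrix.sub_mul, Matrix.mul_sub, Matrix.one_mul, Matrix.mul_one,
      smul_mul_assoc, mul_smul_comm, hsq, smul_smul]
    rw [div_mul_cancel₀ _ hv]
    module

theorem householder_neg (v : ι → ℝ) : householder (-v) = householder v := by
  simp [householder, neg_vecMulVec, vecMulVec_neg]

theorem householder_single_commute_diagonal (i : ι) (d : ι → ℝ) :
    householder (Pi.single i 1) * diagonal d = diagonal d * householder (Pi.single i 1) := by
  have h : householder (Pi.single i (1 : ℝ)) =
      diagonal (1 - (2 : ℝ) • Pi.single i 1) := by
    ext j k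
    by_cases hjk : j = k <;> by_cases hj : j = i <;>
      simp_all [householder, vecMulVec_apply, one_apply, Pi.single_apply]
  rw [h, diagonal_mul_diagonal, diagonal_mul_diagonal]
  simp [mul_comm]

theorem toEuclideanCLM_householder (v : ι → ℝ) (x : EuclideanSpace ℝ ι) :
    toEuclideanCLM (n := ι) (𝕜 := ℝ) (householder v) x =
      (ℝ ∙ (WithLp.toLp 2 v : EuclideanSpace ℝ ι))ᗮ.reflection x := by
  rw [Submodule.reflection_orthogonal_apply, Submodule.reflection_singleton_apply]
  have hnorm : ‖(WithLp.toLp 2 v : EuclideanSpace ℝ ι)‖ ^ 2 = v ⬝ᵥ v := by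
    rw [EuclideanSpace.norm_sq_eq]
    simp [dotProduct, sq]
  have hinner : inner ℝ (WithLp.toLp 2 v : EuclideanSpace ℝ ι) x = v ⬝ᵥ x.ofLp := by
    rw [EuclideanSpace.inner_eq_star_dotProduct]
    simp [dotProduct_comm]
  ext i
  simp [householder, vecMulVec_mulVec, hinner, hnorm]
  ring

theorem exists_prod_householder {U : Matrix ι ι ℝ} (hU : U ∈ unitaryGroup ι ℝ) :
    ∃ l : List (ι → ℝ), U = (l.map householder).prod := by
  let f := toEuclideanCLM (n := ι) (𝕜 := ℝ)
  have hfU : f U ∈ unitary (EuclideanSpace ℝ ι →L[ℝ] EuclideanSpace ℝ ι) :=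
    Unitary.map_mem f hU
  let φ := Unitary.linearIsometryEquiv (𝕜 := ℝ) ⟨f U, hfU⟩
  obtain ⟨l, -, hl⟩ := φ.reflections_generate_dim
  have hprod : ∀ (l : List (EuclideanSpace ℝ ι)) (x : EuclideanSpace ℝ ι),
      f ((l.map fun v => householder v.ofLp).prod) x =
        (l.map fun v => (ℝ ∙ v)ᗮ.reflection).prod x := by
    intro l
    induction l with
    | nil => intro x; simp
    | cons v l ih =>
      intro x
      rw [List.map_cons, List.prod_cons, List.map_cons, List.prod_cons, map_mul,
        mul_apply_eq_comp, ih]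
      exact toEuclideanCLM_householder v.ofLp _
  refine ⟨l.map WithLp.ofLp, f.injective ?_⟩
  ext1 x
  rw [List.map_map]
  refine Eq.trans ?_ (hprod l x).symm
  rw [← hl]
  rfl

theorem joinedIn_conj_householder {c : ℝ} {R : Matrix ι ι ℝ}
    (hR : R ∈ symmetricRotations ι c) (i : ι) {v : ι → ℝ} (hv : v ≠ 0) :
    JoinedIn (symmetricRotations ι c) (householder v * R * householder v)
      (householder (Pi.single i 1) * R * householder (Pi.single i 1)) := by
  wlog hvi : 0 ≤ v i generalizing v
  · simpa only [householder_neg] using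
      this (neg_ne_zero.mpr hv) (by simpa using (not_le.mp hvi).le)
  let w : ℝ → ι → ℝ := fun t => (1 - t) • v + t • Pi.single i 1
  have hw : ∀ t ∈ Set.Icc (0 : ℝ) 1, w t ⬝ᵥ w t ≠ 0 := by
    intro t ht h0
    have hwt : w t = 0 := dotProduct_self_eq_zero.mp h0
    have hi : (1 - t) * v i + t = 0 := by simpa [w] using congrFun hwt i
    have ht0 : t = 0 := by
      have := mul_nonneg (sub_nonneg.mpr ht.2) hvi
      linarith [ht.1]
    exact hv (by simpa [w, ht0] using hwt)
  have hcont : Continuous w := by fun_prop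
  have hH : ContinuousOn (fun t => householder (w t)) (Set.Icc 0 1) := by
    unfold householder
    refine continuousOn_const.sub (ContinuousOn.fun_smul ?_ ?_)
    · exact continuousOn_const.div (hcont.dotProduct hcont).continuousOn hw
    · exact (hcont.matrix_vecMulVec hcont).continuousOn
  refine JoinedIn.ofLine (f := fun t => householder (w t) * R * householder (w t))
    ((hH.mul continuousOn_const).mul hH) (by simp [w]) (by simp [w]) ?_
  rintro _ ⟨t, -, rfl⟩
  have := conj_mem_symmetricRotations hR (U := householder (w t))
    (by rw [householder_transpose, householder_mul_self])
  rwa [householder_transpose] at this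

theorem joinedIn_conj_diagonal {c : ℝ} {d : ι → ℝ} (i : ι)
    (hd : diagonal d ∈ symmetricRotations ι c) {U : Matrix ι ι ℝ} (hU : U ∈ unitaryGroup ι ℝ) :
    JoinedIn (symmetricRotations ι c) (U * diagonal d * Uᵀ) (diagonal d) := by
  obtain ⟨l, rfl⟩ := exists_prod_householder hU
  clear hU
  induction l with
  | nil => simpa using JoinedIn.refl hd
  | cons v l ih =>
    set V := (l.map householder).prod
    have hcons : ((v :: l).map householder).prod * diagonal d *
        ((v :: l).map householder).prodᵀ =
          householder v * (V * diagonal d * Vᵀ) * householder v := by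
      simp only [List.map_cons, List.prod_cons, transpose_mul, householder_transpose,
        Matrix.mul_assoc, V]
    rw [hcons]
    by_cases hv : v = 0
    · simpa [hv, householder] using ih
    set s := householder (Pi.single i (1 : ℝ)) with hs
    have hss : s * s = 1 := householder_mul_self _
    have hst : sᵀ = s := householder_transpose _
    have hfix : s * diagonal d * s = diagonal d := by
      rw [hs, householder_single_commute_diagonal, Matrix.mul_assoc, ← hs, hss, Matrix.mul_one]
    have hmap := ih.map (f := fun A => s * A * s) (by fun_prop)
    simp only [hfix] at hmap
    refine (joinedIn_conj_householder ih.source_mem i hv).trans (hmap.mono ?_)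
    rintro _ ⟨A, hA, rfl⟩
    have := conj_mem_symmetricRotations hA (U := s) (by rw [hst, hss])
    rwa [hst] at this

theorem eq_of_antitone_of_sum_eq {κ : Type*} [Fintype κ] [LinearOrder κ] {f g : κ → ℝ}
    (hf : Antitone f) (hg : Antitone g) (hf1 : ∀ i, f i = 1 ∨ f i = -1)
    (hg1 : ∀ i, g i = 1 ∨ g i = -1) (hsum : ∑ i, f i = ∑ i, g i) : f = g := by
  have key : ∀ {f g : κ → ℝ}, Antitone f → Antitone g → (∀ i, f i = 1 ∨ f i = -1) →
      (∀ i, g i = 1 ∨ g i = -1) → ∑ i, f i = ∑ i, g i → f ≤ g := by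
    intro f g hf hg hf1 hg1 hsum i
    by_contra! hlt
    have hfi : f i = 1 := by grind
    have hgi : g i = -1 := by grind
    refine hsum.not_gt (Finset.sum_lt_sum (fun j _ => ?_) ⟨i, Finset.mem_univ i, hlt⟩)
    rcases le_total j i with hji | hij
    · have := hf hji
      grind
    · have := hg hij
      grind
  exact le_antisymm (key hf hg hf1 hg1 hsum) (key hg hf hg1 hf1 hsum.symm)

theorem isHermitian_of_mem {c : ℝ} {R : Matrix ι ι ℝ} (hR : R ∈ symmetricRotations ι c) :
    R.IsHermitian := by
  rw [IsHermitian, conjTranspose_eq_transpose_of_trivial, hR.2.2.1]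

theorem eigenvalues_eq_one_or_neg_one {c : ℝ} {R : Matrix ι ι ℝ}
    (hR : R ∈ symmetricRotations ι c) (i : ι) :
    (isHermitian_of_mem hR).eigenvalues i = 1 ∨ (isHermitian_of_mem hR).eigenvalues i = -1 := by
  set hH := isHermitian_of_mem hR
  set v : ι → ℝ := ⇑(hH.eigenvectorBasis i)
  have hv : v ≠ 0 := fun h =>
    hH.eigenvectorBasis.orthonormal.ne_zero i (by ext j; exact congrFun h j)
  have hRR : R * R = 1 := by simpa [hR.2.2.1] using hR.1
  have hRv : R *ᵥ v = hH.eigenvalues i • v := hH.mulVec_eigenvectorBasis i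
  have hsq : (hH.eigenvalues i * hH.eigenvalues i) • v = (1 : ℝ) • v := by
    rw [mul_smul, ← hRv, ← mulVec_smul, ← hRv, mulVec_mulVec, hRR, one_mulVec, one_smul]
  exact mul_self_eq_one_iff.mp (smul_left_injective ℝ hv hsq)

theorem eigenvalues_eq_of_mem {c : ℝ} {R S : Matrix ι ι ℝ}
    (hR : R ∈ symmetricRotations ι c) (hS : S ∈ symmetricRotations ι c) :
    (isHermitian_of_mem hR).eigenvalues = (isHermitian_of_mem hS).eigenvalues := by
  let e : Fin (Fintype.card ι) ≃ ι := Fintype.equivOfCardEq (Fintype.card_fin _)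
  have heig : ∀ {A : Matrix ι ι ℝ} (hA : A.IsHermitian) (k : Fin (Fintype.card ι)),
      hA.eigenvalues₀ k = hA.eigenvalues (e k) := fun hA k => by
    simp [IsHermitian.eigenvalues, e]
  have hsum : ∀ {A : Matrix ι ι ℝ} (hA : A ∈ symmetricRotations ι c),
      ∑ k, (isHermitian_of_mem hA).eigenvalues₀ k = c := fun hA => by
    simp only [heig]
    rw [e.sum_comp (isHermitian_of_mem hA).eigenvalues]
    exact (isHermitian_of_mem hA).trace_eq_sum_eigenvalues.symm.trans hA.2.2.2
  have h₀ : (isHermitian_of_mem hR).eigenvalues₀ = (isHermitian_of_mem hS).eigenvalues₀ :=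
    eq_of_antitone_of_sum_eq (IsHermitian.eigenvalues₀_antitone _)
      (IsHermitian.eigenvalues₀_antitone _)
      (fun k => by rw [heig]; exact eigenvalues_eq_one_or_neg_one hR _)
      (fun k => by rw [heig]; exact eigenvalues_eq_one_or_neg_one hS _)
      ((hsum hR).trans (hsum hS).symm)
  unfold IsHermitian.eigenvalues
  rw [h₀]

theorem joinedIn_diagonal_eigenvalues [Nonempty ι] {c : ℝ} {R : Matrix ι ι ℝ}
    (hR : R ∈ symmetricRotations ι c) :
    JoinedIn (symmetricRotations ι c) R (diagonal (isHermitian_of_mem hR).eigenvalues) := by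
  set hH := isHermitian_of_mem hR
  set U : Matrix ι ι ℝ := hH.eigenvectorUnitary.1
  have hU : U ∈ unitaryGroup ι ℝ := hH.eigenvectorUnitary.2
  have hUU : Uᵀ * U = 1 := by
    simpa [star_eq_conjTranspose] using mem_unitaryGroup_iff'.mp hU
  have hspec : R = U * diagonal hH.eigenvalues * Uᵀ := by
    have := hH.spectral_theorem
    rw [Unitary.conjStarAlgAut_apply] at this
    simpa [star_eq_conjTranspose] using this
  have hd : diagonal hH.eigenvalues = Uᵀ * R * Uᵀᵀ := by
    rw [transpose_transpose]
    conv_rhs => rw [hspec]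
    calc diagonal hH.eigenvalues = (Uᵀ * U) * diagonal hH.eigenvalues * (Uᵀ * U) := by
          rw [hUU, Matrix.one_mul, Matrix.mul_one]
      _ = _ := by simp only [Matrix.mul_assoc]
  have hmem : diagonal hH.eigenvalues ∈ symmetricRotations ι c := by
    rw [hd]
    exact conj_mem_symmetricRotations hR
      (by rw [transpose_transpose]; exact mul_eq_one_comm.mp hUU)
  have hjoin := joinedIn_conj_diagonal (Classical.arbitrary ι) hmem hU
  rwa [← hspec] at hjoin

theorem isPathConnected_symmetricRotations [Nonempty ι] {c : ℝ}
    (hne : (symmetricRotations ι c).Nonempty) : IsPathConnected (symmetricRotations ι c) := by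
  refine isPathConnected_iff.mpr ⟨hne, fun R hR S hS => ?_⟩
  refine (joinedIn_diagonal_eigenvalues hR).trans ?_
  rw [eigenvalues_eq_of_mem hR hS]
  exact (joinedIn_diagonal_eigenvalues hS).symm

theorem symmetricRotations_nonempty {n m : ℕ} (hm : 2 * m ≤ n) :
    (symmetricRotations (Fin n) ((n : ℝ) - 4 * m)).Nonempty := by
  obtain ⟨k, rfl⟩ := Nat.exists_eq_add_of_le hm
  let d : Fin (2 * m + k) → ℝ := Fin.append (fun _ => -1) (fun _ => 1)
  refine ⟨diagonal d, ?_, ?_, diagonal_transpose _, ?_⟩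
  · rw [diagonal_transpose, diagonal_mul_diagonal, ← diagonal_one]
    congr 1
    ext i
    refine Fin.addCases (fun i => ?_) (fun i => ?_) i <;> simp [d]
  · simp [d, det_diagonal, Fin.prod_univ_add]
  · simp [d, trace_diagonal, Fin.sum_univ_add]
    ring

end SymmetricRotation

theorem symmetric_rotations_path_connected
    (n m : ℕ) (hn : 1 ≤ n) (hm : 2 * m ≤ n) :
    ({R : Matrix (Fin n) (Fin n) ℝ |
        Rᵀ * R = 1 ∧ R.det = 1 ∧ Rᵀ = R ∧ R.trace = (n : ℝ) - 4 * m}).Nonempty ∧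
    IsPathConnected {R : Matrix (Fin n) (Fin n) ℝ |
        Rᵀ * R = 1 ∧ R.det = 1 ∧ Rᵀ = R ∧ R.trace = (n : ℝ) - 4 * m} := by
  have : Nonempty (Fin n) := ⟨⟨0, hn⟩⟩
  have hne := SymmetricRotation.symmetricRotations_nonempty hm
  exact ⟨hne, SymmetricRotation.isPathConnected_symmetricRotations hne⟩
end

section
/- Let P ∈ ℝ^{n×n} be an orthogonal projection (Pᵀ = P, P² = P), Q = I − P, k > 0, and let R ∈ SO(n) be symmetric (Rᵀ = R) and commute with P (RP = PR). Regard R, P, Q as complex matrices. Suppose b ∈ ℝ and S is a complex n×n matrix with Sᵀ = −S satisfying (i·b)·S = −S·R·P − P·R·S − k·Q·(S·R + R·S)·Q. If S ≠ 0 then b = 0, S·R + R·S = 0, and P·S = S·P. In other words, the linearization F(X) = −XPR − RPX + kRQ(Xᵀ − X)Q of the closed-loop system at the equilibrium R has no nonzero purely imaginary eigenvalue, and every element X = SR of the kernel of F satisfies {S,R} = 0 and [P,S] = 0. -/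
open Matrix

/-- Over matrices, `T ↦ -(R * T)` with `R` an involution has no purely imaginary eigenvalue. -/
theorem eq_zero_of_imaginary_smul_eq_neg_mul {n : ℕ} {R T : Matrix (Fin n) (Fin n) ℂ} {b : ℝ}
    (hR : R * R = 1) (h : (Complex.I * (b : ℂ)) • T = -(R * T)) : T = 0 := by
  have h2 : (Complex.I * (b : ℂ)) • (Complex.I * (b : ℂ)) • T = T := by
    rw [h, smul_neg, ← Matrix.mul_smul, h, Matrix.mul_neg, neg_neg, ← Matrix.mul_assoc, hR,
      Matrix.one_mul]
  have h3 : ((b ^ 2 + 1 : ℝ) : ℂ) • T = 0 := by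
    have : ((b ^ 2 + 1 : ℝ) : ℂ) = 1 - (Complex.I * b) * (Complex.I * b) := by
      push_cast
      linear_combination (b : ℂ) ^ 2 * Complex.I_sq
    rw [this, sub_smul, mul_smul, h2, one_smul, sub_self]
  refine (smul_eq_zero.mp h3).resolve_left ?_
  exact_mod_cast (by positivity : b ^ 2 + 1 ≠ 0)

/-- Over matrices, a multiple of the anticommutator with an involution has no nonzero
purely imaginary eigenvalue. -/
theorem eq_zero_of_imaginary_smul_eq_neg_smul_anticommutator {n : ℕ}
    {R T : Matrix (Fin n) (Fin n) ℂ} {b c : ℝ} (hR : R * R = 1) (hb : b ≠ 0)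
    (h : (Complex.I * (b : ℂ)) • T = -((c : ℂ) • (T * R + R * T))) : T = 0 := by
  have hlam : Complex.I * (b : ℂ) ≠ 0 := by simp [hb]
  have hconj : R * T * R = T := by
    apply smul_right_injective _ hlam
    have := congrArg (fun X => R * X * R) h
    simp only [Matrix.mul_smul, Matrix.smul_mul, Matrix.mul_neg, Matrix.neg_mul] at this
    refine this.trans (Eq.trans ?_ h.symm)
    rw [Matrix.mul_add, Matrix.add_mul, ← Matrix.mul_assoc R R T, hR, Matrix.one_mul,
      Matrix.mul_assoc R, Matrix.mul_assoc T, hR, Matrix.mul_one, add_comm]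
  have hTR : T * R = R * T := by
    conv_lhs => rw [← hconj]
    rw [Matrix.mul_assoc, hR, Matrix.mul_one]
  have h1 : (Complex.I * (b : ℂ)) • T = -((2 * c : ℂ) • (R * T)) := by
    rw [h, hTR, ← two_smul ℂ, smul_smul, mul_comm]
  have h2 : (Complex.I * (b : ℂ)) • (Complex.I * (b : ℂ)) • T = (2 * c * (2 * c) : ℂ) • T := by
    rw [h1, smul_neg, smul_comm, ← Matrix.mul_smul, h1, Matrix.mul_neg, Matrix.mul_smul,
      ← Matrix.mul_assoc, hR, Matrix.one_mul, smul_neg, neg_neg, smul_smul]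
  have h3 : ((b ^ 2 + 4 * c ^ 2 : ℝ) : ℂ) • T = 0 := by
    have : ((b ^ 2 + 4 * c ^ 2 : ℝ) : ℂ) =
        2 * c * (2 * c) - (Complex.I * b) * (Complex.I * b) := by
      push_cast
      linear_combination (b : ℂ) ^ 2 * Complex.I_sq
    rw [this, sub_smul, mul_smul (Complex.I * (b : ℂ)), h2, sub_self]
  refine (smul_eq_zero.mp h3).resolve_left ?_
  exact_mod_cast (by positivity : b ^ 2 + 4 * c ^ 2 ≠ 0)

theorem no_imaginary_eigenvalues_of_linearization
    (n : ℕ) (P Q R : Matrix (Fin n) (Fin n) ℝ) (k : ℝ) (hk : 0 < k)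
    (hPsym : Pᵀ = P) (hPproj : P * P = P) (hQ : Q = 1 - P)
    (hRO : Rᵀ * R = 1) (hdet : R.det = 1) (hRsym : Rᵀ = R)
    (hcomm : R * P = P * R)
    (Pc Qc Rc : Matrix (Fin n) (Fin n) ℂ)
    (hPc : Pc = P.map Complex.ofReal) (hQc : Qc = Q.map Complex.ofReal)
    (hRc : Rc = R.map Complex.ofReal)
    (b : ℝ) (S : Matrix (Fin n) (Fin n) ℂ) (hS : Sᵀ = -S)
    (heq : (Complex.I * (b : ℂ)) • S =
      -(S * Rc * Pc) - Pc * Rc * S - (k : ℂ) • (Qc * (S * Rc + Rc * S) * Qc))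
    (hS0 : S ≠ 0) :
    b = 0 ∧ S * Rc + Rc * S = 0 ∧ Pc * S = S * Pc := by
  have hmul (A B : Matrix (Fin n) (Fin n) ℝ) :
      (A * B).map Complex.ofReal = A.map Complex.ofReal * B.map Complex.ofReal :=
    Matrix.map_mul (f := Complex.ofRealHom)
  have hRR : Rc * Rc = 1 := by
    rw [hRsym] at hRO
    rw [hRc, ← hmul, hRO]
    simp
  have hPP : Pc * Pc = Pc := by rw [hPc, ← hmul, hPproj]
  have hRP : Rc * Pc = Pc * Rc := by rw [hRc, hPc, ← hmul, ← hmul, hcomm]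
  have hQP1 : Qc = 1 - Pc := by
    rw [hQc, hPc, hQ]
    ext i j
    by_cases hij : i = j <;> simp [hij]
  have hPQ : Pc * Qc = 0 := by rw [hQP1, Matrix.mul_sub, hPP, Matrix.mul_one, sub_self]
  have hQP : Qc * Pc = 0 := by rw [hQP1, Matrix.sub_mul, hPP, Matrix.one_mul, sub_self]
  have hQQ : Qc * Qc = Qc := by
    nth_rw 1 [hQP1]
    rw [Matrix.sub_mul, hPQ, Matrix.one_mul, sub_zero]
  have hRQ : Rc * Qc = Qc * Rc := by
    rw [hQP1, Matrix.mul_sub, Matrix.sub_mul, hRP, Matrix.mul_one, Matrix.one_mul]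
  have hadd : Pc + Qc = 1 := by rw [hQP1]; abel
  have hPP' (X : Matrix (Fin n) (Fin n) ℂ) : Pc * (Pc * X) = Pc * X := by
    rw [← Matrix.mul_assoc, hPP]
  have hQQ' (X : Matrix (Fin n) (Fin n) ℂ) : Qc * (Qc * X) = Qc * X := by
    rw [← Matrix.mul_assoc, hQQ]
  have hPQ' (X : Matrix (Fin n) (Fin n) ℂ) : Pc * (Qc * X) = 0 := by
    rw [← Matrix.mul_assoc, hPQ, Matrix.zero_mul]
  have hQP' (X : Matrix (Fin n) (Fin n) ℂ) : Qc * (Pc * X) = 0 := by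
    rw [← Matrix.mul_assoc, hQP, Matrix.zero_mul]
  have hRP' (X : Matrix (Fin n) (Fin n) ℂ) : Rc * (Pc * X) = Pc * (Rc * X) := by
    rw [← Matrix.mul_assoc, hRP, Matrix.mul_assoc]
  have block (A B : Matrix (Fin n) (Fin n) ℂ) := congrArg (fun X => A * X * B) heq
  have hPSP := block Pc Pc
  have hPSQ := block Pc Qc
  have hQSP := block Qc Pc
  have hQSQ := block Qc Qc
  simp only [Matrix.mul_smul, Matrix.smul_mul, Matrix.mul_neg, Matrix.neg_mul, Matrix.mul_sub,
    Matrix.sub_mul, Matrix.mul_add, Matrix.add_mul, Matrix.mul_assoc, hPP', hQQ, hQQ',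
    hPQ', hQP, hQP', hRP, hRQ, Matrix.mul_zero, smul_zero,
    add_zero, sub_zero, neg_zero, zero_sub] at hPSP hPSQ hQSP hQSQ
  have hS12 : Pc * (S * Qc) = 0 := by
    refine eq_zero_of_imaginary_smul_eq_neg_mul (b := b) hRR ?_
    rw [hPSQ, hRP']
  have hS21 : Qc * (S * Pc) = 0 := by
    have h : (Complex.I * (b : ℂ)) • (Qc * (S * Pc))ᵀ = -(Rcᵀ * (Qc * (S * Pc))ᵀ) := by
      rw [← Matrix.transpose_smul, hQSP, ← Matrix.transpose_mul, Matrix.transpose_neg]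
      simp only [Matrix.mul_assoc]
    have hRT : Rcᵀ * Rcᵀ = 1 := by rw [← Matrix.transpose_mul, hRR, Matrix.transpose_one]
    exact Matrix.transpose_eq_zero.mp (eq_zero_of_imaginary_smul_eq_neg_mul hRT h)
  have hanti (A : Matrix (Fin n) (Fin n) ℂ) (hRA : Rc * A = A * Rc) :
      A * (S * A) * Rc + Rc * (A * (S * A)) = A * (S * (A * Rc)) + A * (Rc * (S * A)) := by
    rw [← Matrix.mul_assoc Rc, hRA]
    simp only [Matrix.mul_assoc]
  have h11 : (Complex.I * (b : ℂ)) • (Pc * (S * Pc)) =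
      -(((1 : ℝ) : ℂ) • (Pc * (S * Pc) * Rc + Rc * (Pc * (S * Pc)))) := by
    rw [hPSP, hanti Pc hRP, Complex.ofReal_one, one_smul]
    abel
  have h22 : (Complex.I * (b : ℂ)) • (Qc * (S * Qc)) =
      -((k : ℂ) • (Qc * (S * Qc) * Rc + Rc * (Qc * (S * Qc)))) := by
    rw [hQSQ, hanti Qc hRQ]
  have hdecomp : S = Pc * (S * Pc) + Qc * (S * Qc) := by
    calc S = (Pc + Qc) * (S * (Pc + Qc)) := by rw [hadd, Matrix.one_mul, Matrix.mul_one]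
      _ = _ := by
        rw [Matrix.mul_add S, Matrix.add_mul, Matrix.mul_add, Matrix.mul_add, hS12, hS21,
          add_zero, zero_add]
  have hb : b = 0 := by
    by_contra hb
    apply hS0
    rw [hdecomp, eq_zero_of_imaginary_smul_eq_neg_smul_anticommutator hRR hb h11,
      eq_zero_of_imaginary_smul_eq_neg_smul_anticommutator hRR hb h22, add_zero]
  refine ⟨hb, ?_, ?_⟩
  · have hk' : (k : ℂ) ≠ 0 := by exact_mod_cast hk.ne'
    rw [hb, Complex.ofReal_zero, mul_zero, zero_smul, eq_comm, neg_eq_zero] at h11 h22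
    rw [Complex.ofReal_one, one_smul] at h11
    have h22' := (smul_eq_zero.mp h22).resolve_left hk'
    rw [hdecomp, Matrix.add_mul, Matrix.mul_add, add_add_add_comm, h11, h22', add_zero]
  · have hl : Pc * S = Pc * (S * Pc) := by
      conv_lhs => rw [hdecomp, Matrix.mul_add, hPP', hPQ', add_zero]
    have hr : S * Pc = Pc * (S * Pc) := by
      conv_lhs => rw [hdecomp]
      simp only [Matrix.add_mul, Matrix.mul_assoc, hPP, hQP, Matrix.mul_zero, add_zero]
    rw [hl, ← hr]
end

section
/- Let P ∈ ℝ^{n×n} be an orthogonal projection (Pᵀ = P, P² = P), Q = I − P, k > 0, and let R ∈ SO(n) be symmetric (Rᵀ = R), commute with P (RP = PR), and satisfy R ≠ I. Then there exist a skew-symmetric matrix S ∈ ℝ^{n×n} with S ≠ 0 and a real number λ > 0 such that −(SR)·P·R − R·P·(SR) + k·R·Q·((SR)ᵀ − SR)·Q = λ·(SR). In other words, the linearization of the closed-loop system Ṙ = P − RPR + kRQ(Rᵀ − R)Q is exponentially unstable at every equilibrium R ≠ I. -/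
open Matrix

/-- A nontrivial involution `R` of determinant one commuting with a projection `P` has, outside any
given line, a `-1`-eigenvector that is also an eigenvector of `P`. -/
theorem exists_common_eigenvector_notMem_line {n : ℕ} {P R : Matrix (Fin n) (Fin n) ℝ}
    (hP : P * P = P) (hR : R * R = 1) (hdet : R.det = 1) (hcomm : R * P = P * R) (hRne : R ≠ 1)
    (u : Fin n → ℝ) :
    ∃ (v : Fin n → ℝ) (q : ℝ), R *ᵥ v = -v ∧ P *ᵥ v = q • v ∧ (q = 0 ∨ q = 1) ∧
      ∀ c : ℝ, v ≠ c • u := by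
  by_contra! h
  have hA (x : Fin n → ℝ) : ∃ c : ℝ, (P * (1 - R)) *ᵥ x = c • u := by
    refine h _ 1 ?_ ?_ (Or.inr rfl)
    · rw [mulVec_mulVec, ← neg_mulVec, ← mul_assoc, hcomm, mul_assoc, mul_sub, hR, mul_one,
        ← mul_neg, neg_sub]
    · rw [mulVec_mulVec, ← mul_assoc, hP, one_smul]
  have hB (x : Fin n → ℝ) : ∃ c : ℝ, ((1 - P) * (1 - R)) *ᵥ x = c • u := by
    refine h _ 0 ?_ ?_ (Or.inl rfl)
    · have hc : R * (1 - P) = (1 - P) * R := by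
        rw [mul_sub, sub_mul, hcomm, one_mul, mul_one]
      rw [mulVec_mulVec, ← neg_mulVec, ← mul_assoc, hc, mul_assoc, mul_sub, hR, mul_one,
        ← mul_neg, neg_sub]
    · rw [mulVec_mulVec, ← mul_assoc, mul_sub P, hP, mul_one, sub_self, zero_mul, zero_mulVec,
        zero_smul]
  have hM (x : Fin n → ℝ) : ∃ c : ℝ, (1 - R) *ᵥ x = c • u := by
    obtain ⟨a, ha⟩ := hA x
    obtain ⟨b, hb⟩ := hB x
    refine ⟨a + b, ?_⟩
    rw [add_smul, ← ha, ← hb, ← add_mulVec, ← add_mul, add_sub_cancel, one_mul]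
  choose w hw using fun j => hM (Pi.single j 1)
  have hrank : 1 - R = vecMulVec u w := by
    ext i j
    have := congrFun (hw j) i
    rw [mulVec_single_one] at this
    simpa [vecMulVec_apply, mul_comm] using this
  have hReq : R = 1 + vecMulVec (-u) w := by
    rw [neg_vecMulVec, ← hrank]; abel
  have hwu : w ⬝ᵥ u = 0 := by
    rw [hReq, vecMulVec_eq Unit, det_one_add_replicateCol_mul_replicateRow, dotProduct_neg] at hdet
    linarith
  have hsq : (1 - R) * (1 - R) = 0 := by
    rw [hrank, vecMulVec_mul_vecMulVec, hwu]; simp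
  have htwo : (1 - R) * (1 - R) = (2 : ℝ) • (1 - R) := by
    rw [mul_sub, mul_one, sub_mul, hR, one_mul, two_smul, ← neg_sub 1 R, sub_neg_eq_add]
  rw [hsq] at htwo
  have := (smul_eq_zero.mp htwo.symm).resolve_left two_ne_zero
  exact hRne (sub_eq_zero.mp this).symm

/-- The wedge of two non-proportional vectors is a nonzero matrix. -/
theorem vecMulVec_sub_vecMulVec_ne_zero {n : ℕ} {u v : Fin n → ℝ} (hu : u ≠ 0)
    (hv : ∀ c : ℝ, v ≠ c • u) : vecMulVec u v - vecMulVec v u ≠ 0 := by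
  intro h
  obtain ⟨i, hi⟩ := Function.ne_iff.mp hu
  refine hv (v i / u i) (funext fun j => ?_)
  have hij := congrFun (congrFun h i) j
  simp only [Matrix.sub_apply, vecMulVec_apply, Matrix.zero_apply] at hij
  simp only [Pi.zero_apply] at hi
  simp only [Pi.smul_apply, smul_eq_mul]
  field_simp
  linarith

theorem exponential_instability_at_nonidentity_equilibria
    (n : ℕ) (P Q R : Matrix (Fin n) (Fin n) ℝ) (k : ℝ) (hk : 0 < k)
    (hPsym : Pᵀ = P) (hPproj : P * P = P) (hQ : Q = 1 - P)
    (hRO : Rᵀ * R = 1) (hdet : R.det = 1) (hRsym : Rᵀ = R)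
    (hcomm : R * P = P * R) (hRne : R ≠ 1) :
    ∃ (S : Matrix (Fin n) (Fin n) ℝ) (lam : ℝ), Sᵀ = -S ∧ S ≠ 0 ∧ 0 < lam ∧
      -((S * R) * P * R) - R * P * (S * R) + k • (R * Q * ((S * R)ᵀ - S * R) * Q) =
        lam • (S * R) := by
  have hRR : R * R = 1 := by rwa [hRsym] at hRO
  obtain ⟨u, p, hRu, hPu, hp, hu⟩ :=
    exists_common_eigenvector_notMem_line hPproj hRR hdet hcomm hRne 0
  obtain ⟨v, q, hRv, hPv, hq, hv⟩ :=
    exists_common_eigenvector_notMem_line hPproj hRR hdet hcomm hRne u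
  have hu0 : u ≠ 0 := by simpa using hu 0
  have huR : u ᵥ* R = -u := by rw [← mulVec_transpose, hRsym, hRu]
  have hvR : v ᵥ* R = -v := by rw [← mulVec_transpose, hRsym, hRv]
  have huP : u ᵥ* P = p • u := by rw [← mulVec_transpose, hPsym, hPu]
  have hvP : v ᵥ* P = q • v := by rw [← mulVec_transpose, hPsym, hPv]
  have hSt : (vecMulVec u v - vecMulVec v u)ᵀ = -(vecMulVec u v - vecMulVec v u) := by
    rw [transpose_sub, transpose_vecMulVec, transpose_vecMulVec, neg_sub]
  have hSR : (vecMulVec u v - vecMulVec v u) * R = -(vecMulVec u v - vecMulVec v u) := by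
    rw [sub_mul, vecMulVec_mul, vecMulVec_mul, huR, hvR, vecMulVec_neg, vecMulVec_neg]; abel
  refine ⟨vecMulVec u v - vecMulVec v u, p + q + 2 * k * (1 - p) * (1 - q), hSt,
    vecMulVec_sub_vecMulVec_ne_zero hu0 hv, ?_, ?_⟩
  · rcases hp with rfl | rfl <;> rcases hq with rfl | rfl <;> norm_num [hk]
  · rw [hSR, transpose_neg, hSt, hQ]
    simp only [mul_sub, sub_mul, mul_neg, neg_mul, mul_one, mul_assoc, vecMulVec_mul,
      mul_vecMulVec, vecMulVec_neg, neg_vecMulVec, vecMulVec_smul, smul_vecMulVec, smul_mul_assoc,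
      mul_smul_comm, hRu, hRv, hPu, hPv, huR, hvR, huP, hvP, smul_neg]
    module
end
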